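/- Let C be a linear code in F_q^n containing a codeword c with Hamming weight wt(c) = w > 0. Then there exist a set X_A ⊆ {1,…,n} with |X_A| = w − 1, an index i ∉ X_A, and a vector u ∈ F_q^n with supp(u) ⊆ X_A such that u + e_i ∈ C. Consequently, for any generator matrix G of C, the coordinate x_i is determined by G xᵀ and the coordinates of x on X_A, so a linear index coding scheme based on C is not weakly secure against at least one adversary of strength w − 1. -/

import Mathlib

open Matrix in
/-- Vectors with the same image under `G` pair equally with every vector in the row space. -/
theorem dotProduct_eq_of_mem_span_rows {R m n : Type*} [CommSemiring R] [Fintype n]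
    (G : Matrix m n R) {x x' v : n → R} (hG : G.mulVec x = G.mulVec x')
    (hv : v ∈ Submodule.span R (Set.range fun r => G r)) : v ⬝ᵥ x = v ⬝ᵥ x' := by
  induction hv using Submodule.span_induction with
  | mem v hv =>
    obtain ⟨r, rfl⟩ := hv
    exact congrFun hG r
  | zero => simp
  | add v w _ _ hv hw => rw [add_dotProduct, add_dotProduct, hv, hw]
  | smul a v _ hv => rw [smul_dotProduct, smul_dotProduct, hv]

open Matrix in
/-- Vectors agreeing on a set containing the support of `u` pair equally with `u`. -/
theorem dotProduct_congr_of_support {R n : Type*} [CommSemiring R] [Fintype n]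
    {s : Finset n} {u x x' : n → R} (hu : ∀ j, u j ≠ 0 → j ∈ s)
    (hx : ∀ j ∈ s, x j = x' j) : u ⬝ᵥ x = u ⬝ᵥ x' := by
  refine Finset.sum_congr rfl fun j _ => ?_
  by_cases hj : u j = 0
  · simp [hj]
  · rw [hx j (hu j hj)]

/-- **Theorem 3, part 2.** If `C` contains a codeword of Hamming weight `w > 0`, then
there are a set `X_A` of `w - 1` coordinates, an index `i ∉ X_A`, and a vector `u`
supported on `X_A` with `u + e_i ∈ C`; consequently, for any generator matrix `G` of
`C`, the coordinate `x i` is determined by `G xᵀ` and the coordinates of `x` on `X_A`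
(the scheme is not weakly secure against some adversary of strength `w - 1`). -/
theorem index_coding_not_weakly_secure
    {F : Type*} [Field F] [Fintype F] [DecidableEq F] {n : ℕ}
    (C : Submodule F (Fin n → F)) (c : Fin n → F) (hc : c ∈ C)
    (w : ℕ) (hw : hammingNorm c = w) (hw0 : 0 < w) :
    ∃ (XA : Finset (Fin n)) (i : Fin n) (u : Fin n → F),
      XA.card = w - 1 ∧ i ∉ XA ∧ (∀ j, u j ≠ 0 → j ∈ XA) ∧
      u + Pi.single i 1 ∈ C ∧
      ∀ (k : ℕ) (G : Matrix (Fin k) (Fin n) F),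
        LinearIndependent F (fun r : Fin k => G r) →
        Submodule.span F (Set.range (fun r : Fin k => G r)) = C →
        ∀ x x' : Fin n → F, G.mulVec x = G.mulVec x' →
          (∀ ℓ ∈ XA, x ℓ = x' ℓ) → x i = x' i := by
  obtain ⟨i, hi⟩ : ∃ i, c i ≠ 0 := by
    by_contra! h
    have hc0 : c = 0 := funext h
    simp [hc0] at hw
    omega
  have hmem : ((c i)⁻¹ • c - Pi.single i 1) + Pi.single i 1 ∈ C := by
    rw [sub_add_cancel]
    exact C.smul_mem _ hc
  have hsupp : ∀ j, ((c i)⁻¹ • c - Pi.single i 1 : Fin n → F) j ≠ 0 →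
      j ∈ (Finset.univ.filter fun j => c j ≠ 0).erase i := by
    intro j hj
    rw [Finset.mem_erase, Finset.mem_filter]
    refine ⟨?_, Finset.mem_univ j, ?_⟩
    · rintro rfl
      simp [hi] at hj
    · intro hcj
      have hji : j ≠ i := by
        rintro rfl
        exact hi hcj
      simp [hcj, hji] at hj
  refine ⟨_, i, _, ?_, Finset.notMem_erase i _, hsupp, hmem, ?_⟩
  · rw [Finset.card_erase_of_mem (by simpa using hi), ← hw]
    rfl
  · intro k G _ hspan x x' hG hx
    rw [← hspan] at hmem
    have hdot := dotProduct_eq_of_mem_span_rows G hG hmem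
    rw [add_dotProduct, add_dotProduct, single_one_dotProduct, single_one_dotProduct] at hdot
    rw [dotProduct_congr_of_support hsupp hx] at hdot
    exact add_left_cancel hdot
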